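/- Let ν > 0, x ∈ ℝ and n ∈ ℕ. Then the (n+1) × (n+1) Hankel determinant of normalized ultraspherical polynomials evaluates as det( (i+j)! · C_{i+j}^ν(x) / (2ν)_{i+j} )_{0 ≤ i,j ≤ n} = ((x² - 1)^{n(n+1)/2} / 2^{n²}) · ∏_{r=1}^n [ r! (2ν)_{r-1} / ((ν+1/2)_{r-1} (ν+1/2)_r) ]. -/

import Mathlib

/-- The Pochhammer symbol `(a)_n = a(a+1)⋯(a+n-1)`. -/
noncomputable def poch (a : ℝ) (n : ℕ) : ℝ := ∏ i ∈ Finset.range n, (a + i)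

/-- The ultraspherical (Gegenbauer) polynomial `C_n^ν(x)`. -/
noncomputable def gegenbauerC (ν : ℝ) (n : ℕ) (x : ℝ) : ℝ :=
  ∑ k ∈ Finset.range (n / 2 + 1),
    (-1) ^ k * poch ν (n - k) * (2 * x) ^ (n - 2 * k) /
      (k.factorial * (n - 2 * k).factorial)

lemma poch_succ (a : ℝ) (n : ℕ) : poch a (n + 1) = poch a n * (a + n) := by
  simp [poch, Finset.prod_range_succ]

lemma poch_succ' (a : ℝ) (n : ℕ) : poch a (n + 1) = a * poch (a + 1) n := by
  unfold poch
  rw [Finset.prod_range_succ']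
  simp only [Nat.cast_add, Nat.cast_one, Nat.cast_zero, add_zero]
  rw [mul_comm]
  congr 1
  refine Finset.prod_congr rfl fun i _ => ?_
  ring

lemma poch_zero (a : ℝ) : poch a 0 = 1 := by simp [poch]

lemma poch_pos {a : ℝ} (ha : 0 < a) (n : ℕ) : 0 < poch a n := by
  unfold poch
  exact Finset.prod_pos fun i _ => by positivity

noncomputable def gterm (ν x : ℝ) (n k : ℕ) : ℝ :=
  if 2 * k ≤ n then (-1) ^ k * poch ν (n - k) * (2 * x) ^ (n - 2 * k) /
      (k.factorial * (n - 2 * k).factorial) else 0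

lemma gterm_eq (ν x : ℝ) (k l : ℕ) : gterm ν x (2 * k + l) k =
    (-1) ^ k * poch ν (k + l) * (2 * x) ^ l / (k.factorial * l.factorial) := by
  unfold gterm
  rw [if_pos (by omega), show 2 * k + l - k = k + l by omega, show 2 * k + l - 2 * k = l by omega]

lemma gterm_zero (ν x : ℝ) (n k : ℕ) (h : n < 2 * k) : gterm ν x n k = 0 := by
  unfold gterm
  rw [if_neg (by omega)]

lemma gegen_eq (ν x : ℝ) (n K : ℕ) (hK : n / 2 + 1 ≤ K) :
    gegenbauerC ν n x = ∑ k ∈ Finset.range K, gterm ν x n k := by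
  unfold gegenbauerC
  rw [← Finset.sum_subset (Finset.range_mono hK)]
  · refine Finset.sum_congr rfl fun k hk => ?_
    rw [Finset.mem_range] at hk
    unfold gterm
    rw [if_pos (by omega)]
  · intro k _ hk
    rw [Finset.mem_range] at hk
    exact gterm_zero _ _ _ _ (by omega)

lemma gegenA (v x : ℝ) (n : ℕ) :
    ((n : ℝ) + 2 + v) * gegenbauerC v (n + 2) x =
      v * (gegenbauerC (v + 1) (n + 2) x - gegenbauerC (v + 1) n x) := by
  rw [gegen_eq v x (n + 2) (n + 3) (by omega), gegen_eq (v + 1) x (n + 2) (n + 3) (by omega),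
    gegen_eq (v + 1) x n (n + 2) (by omega), Finset.sum_range_succ' _ (n + 2),
    Finset.sum_range_succ' _ (n + 2)]
  have h0 : ((n : ℝ) + 2 + v) * gterm v x (n + 2) 0 = v * gterm (v + 1) x (n + 2) 0 := by
    have e := gterm_eq v x 0 (n + 2)
    have e' := gterm_eq (v + 1) x 0 (n + 2)
    simp only [mul_zero, zero_add] at e e'
    rw [e, e']
    have h1 := poch_succ v (n + 2)
    rw [poch_succ'] at h1
    push_cast at h1
    linear_combination (-(2 * x) ^ (n + 2) / ((n + 2).factorial : ℝ)) * h1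
  have hs : ∀ k ∈ Finset.range (n + 2), ((n : ℝ) + 2 + v) * gterm v x (n + 2) (k + 1) =
      v * (gterm (v + 1) x (n + 2) (k + 1) - gterm (v + 1) x n k) := by
    intro k _
    by_cases hk : 2 * k ≤ n
    · obtain ⟨l, rfl⟩ := Nat.exists_eq_add_of_le hk
      rw [show 2 * k + l + 2 = 2 * (k + 1) + l by ring, gterm_eq, gterm_eq, gterm_eq]
      have h1 := poch_succ v (k + 1 + l)
      rw [poch_succ'] at h1
      have h2 : poch v (k + 1 + l) = v * poch (v + 1) (k + l) := by
        rw [show k + 1 + l = k + l + 1 by ring, poch_succ']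
      rw [Nat.factorial_succ]
      push_cast at *
      have : (k.factorial : ℝ) ≠ 0 := by positivity
      have : (l.factorial : ℝ) ≠ 0 := by positivity
      have : (k : ℝ) + 1 ≠ 0 := by positivity
      field_simp
      rw [pow_succ]
      linear_combination (2 * x) ^ l * ((-1) ^ k * h1 - (-1) ^ k * (k + 1) * h2)
    · rw [gterm_zero _ _ _ _ (by omega), gterm_zero _ _ _ _ (by omega),
        gterm_zero _ _ _ _ (by omega)]
      ring
  have := Finset.sum_congr rfl hs
  rw [← Finset.mul_sum, ← Finset.mul_sum, Finset.sum_sub_distrib] at this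
  linear_combination this + h0

lemma gegenB (v x : ℝ) (n : ℕ) :
    ((n : ℝ) + 2) * gegenbauerC v (n + 2) x =
      2 * v * (x * gegenbauerC (v + 1) (n + 1) x - gegenbauerC (v + 1) n x) := by
  rw [gegen_eq v x (n + 2) (n + 3) (by omega), gegen_eq (v + 1) x (n + 1) (n + 3) (by omega),
    gegen_eq (v + 1) x n (n + 2) (by omega), Finset.sum_range_succ' _ (n + 2),
    Finset.sum_range_succ' _ (n + 2)]
  have h0 : ((n : ℝ) + 2) * gterm v x (n + 2) 0 = 2 * v * x * gterm (v + 1) x (n + 1) 0 := by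
    have e := gterm_eq v x 0 (n + 2)
    have e' := gterm_eq (v + 1) x 0 (n + 1)
    simp only [mul_zero, zero_add] at e e'
    rw [e, e', Nat.factorial_succ (n + 1), poch_succ' v (n + 1)]
    push_cast
    have : ((n + 1).factorial : ℝ) ≠ 0 := by positivity
    have : (n : ℝ) + 1 + 1 ≠ 0 := by positivity
    field_simp
    ring
  have hs : ∀ k ∈ Finset.range (n + 2), ((n : ℝ) + 2) * gterm v x (n + 2) (k + 1) =
      2 * v * (x * gterm (v + 1) x (n + 1) (k + 1) - gterm (v + 1) x n k) := by
    intro k _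
    by_cases hk : 2 * k ≤ n
    · obtain ⟨l, rfl⟩ := Nat.exists_eq_add_of_le hk
      have hkf : (k.factorial : ℝ) ≠ 0 := by positivity
      have hk1 : (k : ℝ) + 1 ≠ 0 := by positivity
      have h2 : poch v (k + 1 + l) = v * poch (v + 1) (k + l) := by
        rw [show k + 1 + l = k + l + 1 by ring, poch_succ']
      rcases l with _ | l
      · rw [gterm_zero _ _ (2 * k + 0 + 1) _ (by omega),
          show 2 * k + 0 + 2 = 2 * (k + 1) + 0 by ring, gterm_eq, gterm_eq, h2]
        rw [Nat.factorial_succ]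
        push_cast at *
        field_simp
        ring
      · rw [show 2 * k + (l + 1) + 2 = 2 * (k + 1) + (l + 1) by ring,
          show 2 * k + (l + 1) + 1 = 2 * (k + 1) + l by ring, gterm_eq, gterm_eq, gterm_eq, h2,
          show k + 1 + l = k + (l + 1) by ring]
        rw [Nat.factorial_succ, Nat.factorial_succ]
        have : (l.factorial : ℝ) ≠ 0 := by positivity
        have : (l : ℝ) + 1 ≠ 0 := by positivity
        push_cast at *
        field_simp
        ring
    · rw [gterm_zero _ _ _ _ (by omega), gterm_zero _ _ _ _ (by omega),
        gterm_zero _ _ _ _ (by omega)]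
      ring
  have := Finset.sum_congr rfl hs
  rw [← Finset.mul_sum, ← Finset.mul_sum, Finset.sum_sub_distrib, ← Finset.mul_sum] at this
  linear_combination this + h0

lemma gegen_zero (v x : ℝ) : gegenbauerC v 0 x = 1 := by simp [gegenbauerC, poch]

lemma gegen_one (v x : ℝ) : gegenbauerC v 1 x = 2 * v * x := by
  simp [gegenbauerC, poch]; ring

/-- from A and B -/
lemma gegenC (v x : ℝ) (n : ℕ) :
    ((n : ℝ) + 2 + 2 * v) * gegenbauerC v (n + 2) x =
      2 * v * (gegenbauerC (v + 1) (n + 2) x - x * gegenbauerC (v + 1) (n + 1) x) := by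
  linear_combination 2 * gegenA v x n - gegenB v x n

lemma gegenC1 (v x : ℝ) :
    (1 + 2 * v) * gegenbauerC v 1 x =
      2 * v * (gegenbauerC (v + 1) 1 x - x * gegenbauerC (v + 1) 0 x) := by
  rw [gegen_one, gegen_one, gegen_zero]; ring

lemma gegenI (v x : ℝ) (n : ℕ) :
    ((n : ℝ) + 2) * gegenbauerC v (n + 2) x =
      x * (2 * v + n + 1) * gegenbauerC v (n + 1) x +
        2 * v * (x ^ 2 - 1) * gegenbauerC (v + 1) n x := by
  have hb := gegenB v x n
  have hc : ((n : ℝ) + 1 + 2 * v) * gegenbauerC v (n + 1) x =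
      2 * v * (gegenbauerC (v + 1) (n + 1) x - x * gegenbauerC (v + 1) n x) := by
    rcases n with _ | n
    · simpa using gegenC1 v x
    · have := gegenC v x n
      push_cast
      linear_combination this
  linear_combination hb - x * hc

noncomputable def mm (v x : ℝ) (n : ℕ) : ℝ := (n.factorial : ℝ) * gegenbauerC v n x / poch (2 * v) n

lemma mm_zero (v x : ℝ) : mm v x 0 = 1 := by simp [mm, gegen_zero, poch_zero]

lemma mm_one (v x : ℝ) (hv : 0 < v) : mm v x 1 = x := by
  simp [mm, gegen_one, poch]; field_simp

lemma mmI (v x : ℝ) (hv : 0 < v) (n : ℕ) :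
    mm v x (n + 2) = x * mm v x (n + 1) + (n + 1) * (x ^ 2 - 1) / (2 * v + 1) * mm (v + 1) x n := by
  have h := gegenI v x n
  have e1 : poch (2 * v) (n + 2) = poch (2 * v) (n + 1) * (2 * v + n + 1) := by
    rw [poch_succ]; push_cast; ring
  have e2 : poch (2 * v) (n + 2) = 2 * v * (2 * v + 1) * poch (2 * (v + 1)) n := by
    rw [poch_succ', poch_succ', show 2 * v + 1 + 1 = 2 * (v + 1) by ring]; ring
  have p : 0 < poch (2 * (v + 1)) n := poch_pos (by positivity) n
  have e3 : poch (2 * v) (n + 1) = 2 * v * (2 * v + 1) * poch (2 * (v + 1)) n / (2 * v + n + 1) := by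
    rw [← e2, e1]; field_simp
  unfold mm
  rw [e3, e2, Nat.factorial_succ (n + 1), Nat.factorial_succ n]
  push_cast
  field_simp
  linear_combination h

lemma mmII (v x : ℝ) (hv : 0 < v) (n : ℕ) :
    mm v x (n + 2) = mm (v + 1) x (n + 2) +
      (n + 2) * (n + 1) * (x ^ 2 - 1) / ((2 * v + 1) * (2 * v + 3)) * mm (v + 2) x n := by
  have h := gegenI (v + 1) x n
  have hc := gegenC v x n
  rw [show v + 1 + 1 = v + 2 by ring] at h
  have p : 0 < poch (2 * (v + 2)) n := poch_pos (by positivity) n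
  have e2 : poch (2 * (v + 1)) (n + 2) = (2 * v + 2) * (2 * v + 3) * poch (2 * (v + 2)) n := by
    rw [poch_succ', poch_succ', show 2 * (v + 1) + 1 + 1 = 2 * (v + 2) by ring]; ring
  have e3 : poch (2 * v) (n + 2) * ((2 * v + n + 2) * (2 * v + n + 3)) =
      2 * v * (2 * v + 1) * poch (2 * (v + 1)) (n + 2) := by
    have : poch (2 * v) (n + 4) = poch (2 * v) (n + 2) * ((2 * v + n + 2) * (2 * v + n + 3)) := by
      rw [poch_succ, poch_succ]; push_cast; ring
    rw [← this, poch_succ', poch_succ', show 2 * v + 1 + 1 = 2 * (v + 1) by ring]; ring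
  have e4 : poch (2 * v) (n + 2) = 2 * v * (2 * v + 1) * ((2 * v + 2) * (2 * v + 3) *
      poch (2 * (v + 2)) n) / ((2 * v + n + 2) * (2 * v + n + 3)) := by
    rw [← e2, ← e3]; field_simp
  unfold mm
  rw [e4, e2, Nat.factorial_succ (n + 1), Nat.factorial_succ n]
  push_cast
  field_simp
  linear_combination (n + 2) * ((2 * v + n + 3) * hc + 2 * v * h)

noncomputable def AA (v x : ℝ) (n k : ℕ) : ℝ := (n.choose k : ℝ) * mm (v + k) x (n - k)

noncomputable def bb (v x : ℝ) : ℕ → ℝ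
  | 0 => (x ^ 2 - 1) / (2 * v + 1)
  | k + 1 => (x ^ 2 - 1) * (k + 2) * (2 * v + k) / ((2 * v + 1 + 2 * k) * (2 * v + 3 + 2 * k))

noncomputable def dd (v x : ℝ) : ℕ → ℝ
  | 0 => 1
  | k + 1 => dd v x k * bb v x k

lemma AA_lt (v x : ℝ) (n k : ℕ) (h : n < k) : AA v x n k = 0 := by
  simp [AA, Nat.choose_eq_zero_of_lt h]

lemma AA_self (v x : ℝ) (n : ℕ) : AA v x n n = 1 := by
  simp [AA, mm_zero]

lemma AA_zero (v x : ℝ) (n : ℕ) : AA v x n 0 = mm v x n := by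
  simp [AA]

lemma AA_rec0 (v x : ℝ) (hv : 0 < v) (n : ℕ) :
    AA v x (n + 1) 0 = x * AA v x n 0 + bb v x 0 * AA v x n 1 := by
  rcases n with _ | n
  · rw [AA_zero, AA_zero, mm_zero, AA_lt _ _ _ _ one_pos, zero_add, mm_one _ _ hv]; ring
  · rw [AA_zero, AA_zero, mmI _ _ hv]
    simp [AA, bb]
    ring

lemma AA_rec (v x : ℝ) (hv : 0 < v) (n k : ℕ) :
    AA v x (n + 1) (k + 1) =
      AA v x n k + x * AA v x n (k + 1) + bb v x (k + 1) * AA v x n (k + 2) := by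
  rcases lt_or_ge n k with h | h
  · rw [AA_lt _ _ _ _ h, AA_lt _ _ _ _ (by omega), AA_lt _ _ _ _ (by omega),
      AA_lt _ _ _ _ (by omega)]; ring
  obtain ⟨N, rfl⟩ := Nat.exists_eq_add_of_le h
  rcases N with _ | _ | t
  · rw [add_zero, AA_self, AA_self, AA_lt _ _ _ _ (by omega), AA_lt _ _ _ _ (by omega)]; ring
  · rw [zero_add, AA_self, AA_lt _ _ k.succ (k + 2) (by omega)]
    simp only [AA]
    rw [show k + 1 + 1 - (k + 1) = 1 by omega, show k + 1 - k = 1 by omega,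
      mm_one _ _ (by positivity), mm_one _ _ (by positivity), Nat.choose_succ_self_right,
      Nat.choose_succ_self_right]
    push_cast
    ring
  · simp only [AA]
    have c1 := Nat.choose_succ_right_eq (k + (t + 1 + 1)) k
    have c2 := Nat.choose_succ_right_eq (k + (t + 1 + 1)) (k + 1)
    have c3 := Nat.choose_succ_succ' (k + (t + 1 + 1)) k
    rw [show k + (t + 1 + 1) - k = t + 2 by omega] at c1
    rw [show k + (t + 1 + 1) - (k + 1) = t + 1 by omega, show k + 1 + 1 = k + 2 by rfl] at c2
    rw [show k + (t + 1 + 1) - k = t + 2 by omega, show k + (t + 1 + 1) - (k + 1) = t + 1 by omega,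
      show k + (t + 1 + 1) - (k + 2) = t by omega,
      show k + (t + 1 + 1) + 1 - (k + 1) = t + 2 by omega, c3]
    generalize (k + (t + 1 + 1)).choose k = p at *
    generalize (k + (t + 1 + 1)).choose (k + 1) = q at *
    generalize (k + (t + 1 + 1)).choose (k + 2) = r at *
    have c1' : (q : ℝ) * (k + 1) = p * (t + 2) := by exact_mod_cast c1
    have c2' : (r : ℝ) * (k + 2) = q * (t + 1) := by exact_mod_cast c2
    have hp : (p : ℝ) = q * (k + 1) / (t + 2) := by field_simp; linarith
    have hr : (r : ℝ) = q * (t + 1) / (k + 2) := by field_simp; linarith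
    have hI := mmI (v + (k + 1)) x (by positivity) t
    have hII := mmII (v + k) x (by positivity) t
    push_cast
    rw [show v + (k : ℝ) + 1 = v + (k + 1) by ring] at hII
    rw [show v + ((k : ℝ) + 1) + 1 = v + (k + 2) by ring] at hI
    rw [show v + (k : ℝ) + 2 = v + (k + 2) by ring] at hII
    rw [hp, hr, hII, bb]
    generalize mm (v + (k + 1)) x (t + 2) = m2 at *
    generalize mm (v + (k + 1)) x (t + 1) = m1 at *
    generalize mm (v + (k + 2)) x t = m0 at *
    rw [hI]
    have : 2 * (v + (k : ℝ)) + 1 ≠ 0 := by positivity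
    have : 2 * (v + (k : ℝ)) + 3 ≠ 0 := by positivity
    rw [show 2 * (v + ((k : ℝ) + 1)) + 1 = 2 * (v + k) + 3 by ring,
      show 2 * v + 1 + 2 * (k : ℝ) = 2 * (v + k) + 1 by ring,
      show 2 * v + 3 + 2 * (k : ℝ) = 2 * (v + k) + 3 by ring]
    field_simp
    ring

lemma tele (v x : ℝ) (hv : 0 < v) (i j K : ℕ) :
    ∑ k ∈ Finset.range (K + 1), AA v x (i + 1) k * dd v x k * AA v x j k -
      ∑ k ∈ Finset.range (K + 1), AA v x i k * dd v x k * AA v x (j + 1) k =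
    dd v x (K + 1) * (AA v x i (K + 1) * AA v x j K - AA v x i K * AA v x j (K + 1)) := by
  induction K with
  | zero =>
    simp only [zero_add, Finset.sum_range_one, dd]
    rw [AA_rec0 _ _ hv, AA_rec0 _ _ hv]
    ring
  | succ K ih =>
    rw [Finset.sum_range_succ, Finset.sum_range_succ _ (K + 1), AA_rec _ _ hv, AA_rec _ _ hv]
    rw [show dd v x (K + 1 + 1) = dd v x (K + 1) * bb v x (K + 1) from rfl]
    linear_combination ih

lemma hank (v x : ℝ) (hv : 0 < v) (K i : ℕ) : ∀ j, i + j ≤ K →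
    ∑ k ∈ Finset.range (K + 1), AA v x i k * dd v x k * AA v x j k = mm v x (i + j) := by
  induction i with
  | zero =>
    intro j _
    rw [Finset.sum_eq_single 0]
    · rw [AA_zero, AA_zero, mm_zero]; simp [dd]
    · intro k _ hk
      rw [AA_lt _ _ _ _ (by omega)]; ring
    · simp
  | succ i ih =>
    intro j h
    have t := tele v x hv i j K
    rw [AA_lt _ _ i (K + 1) (by omega), AA_lt _ _ j (K + 1) (by omega), ih (j + 1) (by omega)] at t
    rw [show i + 1 + j = i + (j + 1) by ring]
    linear_combination t

lemma hank' (v x : ℝ) (hv : 0 < v) (n i j : ℕ) (hi : i ≤ n) :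
    ∑ k ∈ Finset.range (n + 1), AA v x i k * dd v x k * AA v x j k = mm v x (i + j) := by
  rw [← hank v x hv (n + i + j) i j (by omega)]
  refine Finset.sum_subset (Finset.range_mono (by omega)) ?_
  intro k _ hk
  rw [Finset.mem_range] at hk
  rw [AA_lt _ _ _ _ (by omega)]; ring

lemma dd_eq (v x : ℝ) (hv : 0 < v) (n : ℕ) : dd v x (n + 1) =
    (x ^ 2 - 1) ^ (n + 1) / 2 ^ (2 * n + 1) * (((n + 1).factorial : ℝ) * poch (2 * v) n /
            (poch (v + 1 / 2) n * poch (v + 1 / 2) (n + 1))) := by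
  induction n with
  | zero => simp [dd, bb, poch]; field_simp
  | succ n ih =>
    rw [dd, ih, bb]
    have p : 0 < poch (v + 1 / 2) n := poch_pos (by positivity) n
    rw [Nat.factorial_succ (n + 1), poch_succ (2 * v), poch_succ (v + 1 / 2) (n + 1),
      poch_succ (v + 1 / 2) n]
    have e1 : v + 1 / 2 + (n : ℝ) = (2 * v + 1 + 2 * n) / 2 := by ring
    have e2 : v + 1 / 2 + ((n + 1 : ℕ) : ℝ) = (2 * v + 3 + 2 * n) / 2 := by push_cast; ring
    rw [e1, e2]
    push_cast
    field_simp
    ring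

/-- Hankel determinant of normalized ultraspherical polynomials. -/
theorem hankel_det_ultraspherical (ν : ℝ) (hν : 0 < ν) (x : ℝ) (n : ℕ) :
    Matrix.det (Matrix.of fun i j : Fin (n + 1) =>
        (((i : ℕ) + (j : ℕ)).factorial : ℝ) * gegenbauerC ν ((i : ℕ) + (j : ℕ)) x /
          poch (2 * ν) ((i : ℕ) + (j : ℕ))) =
      (x ^ 2 - 1) ^ (n * (n + 1) / 2) / 2 ^ (n ^ 2) *
        ∏ r ∈ Finset.Icc 1 n,
          (r.factorial : ℝ) * poch (2 * ν) (r - 1) /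
            (poch (ν + 1 / 2) (r - 1) * poch (ν + 1 / 2) r) := by
  have hM : (Matrix.of fun i j : Fin (n + 1) =>
        (((i : ℕ) + (j : ℕ)).factorial : ℝ) * gegenbauerC ν ((i : ℕ) + (j : ℕ)) x /
          poch (2 * ν) ((i : ℕ) + (j : ℕ))) =
      (Matrix.of fun i k : Fin (n + 1) => AA ν x i k) *
        Matrix.diagonal (fun k : Fin (n + 1) => dd ν x k) *
        (Matrix.of fun i k : Fin (n + 1) => AA ν x i k).transpose := by
    ext i j
    rw [Matrix.mul_apply]
    simp only [Matrix.mul_diagonal, Matrix.of_apply, Matrix.transpose_apply]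
    rw [Fin.sum_univ_eq_sum_range (fun k => AA ν x i k * dd ν x k * AA ν x j k) (n + 1),
      hank' ν x hν n i j (by omega)]
    rfl
  have hL : (Matrix.of fun i k : Fin (n + 1) => AA ν x i k).det = 1 := by
    rw [Matrix.det_of_isLowerTriangular]
    · simp [AA_self]
    · intro i j hij
      exact AA_lt _ _ _ _ hij
  rw [hM, Matrix.det_mul, Matrix.det_mul, Matrix.det_transpose, hL, Matrix.det_diagonal, one_mul,
    mul_one, Fin.prod_univ_eq_prod_range (fun k => dd ν x k) (n + 1)]
  clear hM hL
  induction n with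
  | zero => simp [dd]
  | succ n ih =>
    rw [Finset.prod_range_succ, ih, Finset.prod_Icc_succ_top (by omega), dd_eq ν x hν n,
      Nat.add_sub_cancel]
    have e : (n + 1) * (n + 1 + 1) / 2 = n * (n + 1) / 2 + (n + 1) := by
      rw [show (n + 1) * (n + 1 + 1) = n * (n + 1) + (n + 1) * 2 by ring,
        Nat.add_mul_div_right _ _ (by norm_num)]
    rw [e, show (n + 1) ^ 2 = n ^ 2 + (2 * n + 1) by ring, pow_add, pow_add (2 : ℝ)]
    ring
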